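/- The graceful chromatic number of the complete graph K_12 is 30; a graceful 30-coloring is given by assigning the twelve vertices the colors 1, 3, 4, 8, 9, 11, 20, 22, 23, 27, 28, 30. -/

import Mathlib

/-- The induced edge coloring `g*(ab) = |g a - g b|` is proper: any two edges sharing a
vertex receive distinct values. -/
def GracefulEdgeProper {V : Type*} (G : SimpleGraph V) (g : V → ℕ) : Prop :=
  ∀ a b c : V, G.Adj a b → G.Adj a c → b ≠ c →
    Nat.dist (g a) (g b) ≠ Nat.dist (g a) (g c)

/-- A graceful coloring: a proper vertex coloring by positive integers whose induced
edge coloring is proper. -/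
def IsGracefulColoring {V : Type*} (G : SimpleGraph V) (g : V → ℕ) : Prop :=
  (∀ v, 1 ≤ g v) ∧ (∀ a b : V, G.Adj a b → g a ≠ g b) ∧ GracefulEdgeProper G g

/-- A graceful `l`-coloring: a proper vertex coloring with colors in `{1, …, l}` whose
induced edge coloring is proper. -/
def IsGracefulLColoring {V : Type*} (G : SimpleGraph V) (l : ℕ) (g : V → ℕ) : Prop :=
  (∀ v, g v ∈ Finset.Icc 1 l) ∧ (∀ a b : V, G.Adj a b → g a ≠ g b) ∧ GracefulEdgeProper G g

/-- The graceful chromatic number: the least `l ≥ 2` admitting a graceful `l`-coloring. -/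
noncomputable def gracefulChromaticNumber {V : Type*} (G : SimpleGraph V) : ℕ :=
  sInf {l | 2 ≤ l ∧ ∃ g : V → ℕ, IsGracefulLColoring G l g}

/-- A finite set of naturals is 3-AP-free: no three distinct elements `a, b, c`
with `b - a = c - b`. -/
def ThreeAPFreeSet (S : Finset ℕ) : Prop :=
  ∀ a ∈ S, ∀ b ∈ S, ∀ c ∈ S, a ≠ b → b ≠ c → a ≠ c → (b : ℤ) - (a : ℤ) ≠ (c : ℤ) - (b : ℤ)

open Finset

/-- Branch-and-bound test for choosing `need` elements in a window of `k` further positions without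
creating a three-term progression. Bit `i` of `S` records that the position `i + 1` steps back was
chosen, bit `i` of `F` that the position `i` steps ahead is forbidden, and `t` lists upper bounds
for the number of elements that can be chosen in a window of each length. -/
def canChoose (t : List ℕ) : ℕ → ℕ → ℕ → ℕ → Bool
  | 0, need, _, _ => need == 0
  | k + 1, need, S, F =>
    Nat.ble need (t.getD (k + 1) (k + 1)) &&
      ((F % 2 == 0 && canChoose t k (need - 1) (2 * S + 1) (F / 2 ||| S)) ||
        canChoose t k need (2 * S) (F / 2))

/-- `t` bounds the sizes of progression-free sets in windows: such a set has at most `t[k]` elements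
among any `k` consecutive naturals (nothing is claimed beyond the end of `t`). -/
def IsWindowBound (t : List ℕ) : Prop :=
  ∀ T : Finset ℕ, ThreeAPFree (T : Set ℕ) → ∀ x k, #(T ∩ Ico x (x + k)) ≤ t.getD k k

/-- Check that the entries of the second list may be appended to the first one, one by one. -/
def certifyBounds : List ℕ → List ℕ → Bool
  | _, [] => true
  | t, m :: r => !canChoose t t.length (m + 1) 0 0 && certifyBounds (t ++ [m]) r

lemma canChoose_of_le_card {t : List ℕ} (ht : IsWindowBound t) {T : Finset ℕ}
    (hT : ThreeAPFree (T : Set ℕ)) (k : ℕ) :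
    ∀ need S F x, (∀ i, S.testBit i → ∃ y ∈ T, y + 1 + i = x) →
      (∀ i, F.testBit i → x + i ∉ T) → need ≤ #(T ∩ Ico x (x + k)) →
      canChoose t k need S F = true := by
  induction k with
  | zero =>
    intro need S F x _ _ h
    simpa [canChoose] using h
  | succ k ih =>
    intro need S F x hS hF h
    have hbound := h.trans (ht T hT x (k + 1))
    have hIco : Ico x (x + (k + 1)) = insert x (Ico (x + 1) (x + 1 + k)) := by
      ext y
      simp only [mem_Ico, mem_insert]
      omega
    rw [canChoose, Bool.and_eq_true, Bool.or_eq_true, Bool.and_eq_true]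
    refine ⟨Nat.ble_eq_true_of_le hbound, ?_⟩
    have hF' : ∀ i, (F / 2).testBit i → x + 1 + i ∉ T := fun i hi => by
      rw [Nat.testBit_div_two] at hi
      simpa [add_assoc, add_comm 1 i] using hF _ hi
    by_cases hx : x ∈ T
    · left
      have hF0 : F % 2 = 0 := by
        by_contra hne
        exact hF 0 (by simp [Nat.testBit_zero]; omega) hx
      refine ⟨by simpa using hF0, ih _ _ _ (x + 1) ?_ ?_ ?_⟩
      · rintro (_ | i) hi
        · exact ⟨x, hx, rfl⟩
        · rw [Nat.testBit_succ, show (2 * S + 1) / 2 = S by omega] at hi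
          obtain ⟨y, hy, hyx⟩ := hS i hi
          exact ⟨y, hy, by omega⟩
      · intro i hi
        rw [Nat.testBit_or, Bool.or_eq_true] at hi
        rcases hi with hi | hi
        · exact hF' i hi
        · obtain ⟨y, hy, hyx⟩ := hS i hi
          intro hz
          have := hT (mem_coe.2 hy) (mem_coe.2 hx) (mem_coe.2 hz) (by omega)
          omega
      · rw [hIco, inter_insert_of_mem hx, card_insert_of_notMem (by simp)] at h
        omega
    · right
      refine ih _ _ _ (x + 1) ?_ hF' ?_
      · rintro (_ | i) hi
        · simp at hi
        · rw [Nat.testBit_succ, show 2 * S / 2 = S by omega] at hi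
          obtain ⟨y, hy, hyx⟩ := hS i hi
          exact ⟨y, hy, by omega⟩
      · rwa [hIco, inter_insert_of_notMem hx] at h

lemma isWindowBound_nil : IsWindowBound [] := fun T _ x k => by
  simpa using card_le_card (inter_subset_right : T ∩ Ico x (x + k) ⊆ _)

lemma IsWindowBound.append_singleton {t : List ℕ} (ht : IsWindowBound t) {m : ℕ}
    (h : canChoose t t.length (m + 1) 0 0 = false) : IsWindowBound (t ++ [m]) := by
  intro T hT x k
  rcases lt_trichotomy k t.length with hk | rfl | hk
  · rw [List.getD_append _ _ _ _ hk]
    exact ht T hT x k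
  · by_contra! hlt
    have := canChoose_of_le_card ht hT t.length (m + 1) 0 0 x (by simp) (by simp)
      (by simpa [Nat.succ_le_iff] using hlt)
    simp [h] at this
  · have := ht T hT x k
    rw [List.getD_eq_default _ _ hk.le] at this
    rwa [List.getD_eq_default _ _ (by simpa using hk)]

lemma IsWindowBound.append {t r : List ℕ} (ht : IsWindowBound t)
    (h : certifyBounds t r = true) : IsWindowBound (t ++ r) := by
  induction r generalizing t with
  | nil => simpa using ht
  | cons m r ih =>
    simp only [certifyBounds, Bool.and_eq_true, Bool.not_eq_true'] at h
    simpa using ih (ht.append_singleton h.1) h.2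

/-- The largest sizes of progression-free sets in windows of length `0, …, 29`. -/
lemma isWindowBound_thirty : IsWindowBound
    [0, 1, 2, 2, 3, 4, 4, 4, 4, 5, 5, 6, 6, 7, 8, 8, 8, 8, 8, 8, 9, 9, 9, 9, 10, 10, 11, 11, 11,
      11] :=
  isWindowBound_nil.append (by decide +kernel)

lemma IsGracefulLColoring.injective {V : Type*} {l : ℕ} {g : V → ℕ}
    (hg : IsGracefulLColoring (⊤ : SimpleGraph V) l g) : Function.Injective g :=
  fun a b hab => by_contra fun hne => hg.2.1 a b hne hab

lemma IsGracefulLColoring.threeAPFree_range {V : Type*} {l : ℕ} {g : V → ℕ}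
    (hg : IsGracefulLColoring (⊤ : SimpleGraph V) l g) : ThreeAPFree (Set.range g) := by
  rintro _ ⟨a, rfl⟩ _ ⟨b, rfl⟩ _ ⟨c, rfl⟩ h
  by_contra hab
  have hba : b ≠ a := fun e => hab (e ▸ rfl)
  have hbc : b ≠ c := by
    rintro rfl
    omega
  have hac : a ≠ c := by
    rintro rfl
    omega
  refine hg.2.2 b a c hba hbc hac ?_
  simp only [Nat.dist]
  omega

lemma isGracefulLColoring_K12 :
    IsGracefulLColoring (⊤ : SimpleGraph (Fin 12)) 30
      ![1, 3, 4, 8, 9, 11, 20, 22, 23, 27, 28, 30] := by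
  simp only [IsGracefulLColoring, GracefulEdgeProper, SimpleGraph.top_adj, Nat.dist]
  decide +kernel

theorem gracefulChromatic_K12 :
    gracefulChromaticNumber (⊤ : SimpleGraph (Fin 12)) = 30 ∧
      IsGracefulLColoring (⊤ : SimpleGraph (Fin 12)) 30 ![1, 3, 4, 8, 9, 11, 20, 22, 23, 27, 28, 30] := by
  refine ⟨IsLeast.csInf_eq ⟨⟨by norm_num, _, isGracefulLColoring_K12⟩, ?_⟩,
    isGracefulLColoring_K12⟩
  rintro l ⟨-, g, hg⟩
  by_contra! hl
  have hfree : ThreeAPFree ((univ.image g : Finset ℕ) : Set ℕ) := by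
    simpa using hg.threeAPFree_range
  have hsub : univ.image g ⊆ Ico 1 (1 + 29) := by
    intro y hy
    obtain ⟨v, -, rfl⟩ := mem_image.1 hy
    have := mem_Icc.1 (hg.1 v)
    exact mem_Ico.2 (by omega)
  have hcard := isWindowBound_thirty _ hfree 1 29
  rw [inter_eq_left.2 hsub, card_image_of_injective _ hg.injective] at hcard
  simp at hcard
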